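/- Every skew Heyting algebra (S;∧,∨,→,1) satisfies the identities: (SH1) x→x = 1; (SH2) x∧(x→y)∧x = x∧y∧x; (SH3) y∧(x→y) = y and (x→y)∧y = y; (SH4) x→(u∨(y∧z)∨u) = (x→(u∨y∨u))∧(x→(u∨z∨u)). -/

import Mathlib

/-- A skew lattice: both operations idempotent, associative, with the four absorption laws. -/
structure SkewLattice (S : Type*) where
  m : S → S → S  -- meet ∧
  j : S → S → S  -- join ∨
  m_idem : ∀ x, m x x = x
  j_idem : ∀ x, j x x = x
  m_assoc : ∀ x y z, m (m x y) z = m x (m y z)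
  j_assoc : ∀ x y z, j (j x y) z = j x (j y z)
  abs1 : ∀ x y, m x (j x y) = x
  abs2 : ∀ x y, j x (m x y) = x
  abs3 : ∀ x y, j (m x y) y = y
  abs4 : ∀ x y, m (j x y) y = y

namespace SkewLattice

variable {S : Type*}

/-- Natural partial order: x ≤ y iff x∨y = y = y∨x. -/
def nle (L : SkewLattice S) (x y : S) : Prop := L.j x y = y ∧ L.j y x = y

/-- Natural preorder: x ⪯ y iff y∨x∨y = y. -/
def npre (L : SkewLattice S) (x y : S) : Prop := L.j (L.j y x) y = y

/-- Green's relation D: x D y iff x ⪯ y and y ⪯ x. -/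
def dRel (L : SkewLattice S) (x y : S) : Prop := L.npre x y ∧ L.npre y x

/-- Green's relation L. -/
def lRel (L : SkewLattice S) (x y : S) : Prop := L.m x y = x ∧ L.m y x = y

/-- Green's relation R. -/
def rRel (L : SkewLattice S) (x y : S) : Prop := L.m x y = y ∧ L.m y x = x

/-- Co-strong distributivity. -/
def CoStronglyDistributive (L : SkewLattice S) : Prop :=
  (∀ x y z, L.j x (L.m y z) = L.m (L.j x y) (L.j x z)) ∧
  (∀ x y z, L.j (L.m x y) z = L.m (L.j x z) (L.j y z))

/-- Conormality: x∨y∨z∨w = x∨z∨y∨w. -/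
def Conormal (L : SkewLattice S) : Prop :=
  ∀ x y z w, L.j (L.j (L.j x y) z) w = L.j (L.j (L.j x z) y) w

/-- t is a top: x∨t = t = t∨x for all x. -/
def IsTop (L : SkewLattice S) (t : S) : Prop := ∀ x, L.j x t = t ∧ L.j t x = t

/-- `h` is a skew Heyting implication for the skew lattice `L`:
(i) x→y = (y∨x∨y)→y, and (ii) whenever y ≤ x, x→y is the greatest element w
of the upset y↑ satisfying w∧x ≤ y. -/
def IsSkewHeytingImp (L : SkewLattice S) (h : S → S → S) : Prop :=
  (∀ x y, h x y = h (L.j (L.j y x) y) y) ∧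
  (∀ x y, L.nle y x →
     L.nle y (h x y) ∧ L.nle (L.m (h x y) x) y ∧
     ∀ w, L.nle y w → L.nle (L.m w x) y → L.nle w (h x y))

end SkewLattice

open SkewLattice

/-- A skew Heyting algebra: a co-strongly distributive skew lattice with top 1 together
with an implication satisfying (i) and (ii) above. -/
structure SkewHeytingAlgebra (S : Type*) extends SkewLattice S where
  himp : S → S → S
  one : S
  costrong : toSkewLattice.CoStronglyDistributive
  top : toSkewLattice.IsTop one
  himp_spec : toSkewLattice.IsSkewHeytingImp himp

namespace SkewLattice

variable {S : Type*} {L : SkewLattice S} {p a b c : S}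

theorem j_eq_right_of_m_eq_left (h : L.m a b = a) : L.j a b = b := by
  rw [← h, L.abs3]

theorem j_eq_left_of_m_eq_right (h : L.m a b = b) : L.j a b = a := by
  rw [← h, L.abs2]

theorem m_eq_left_of_j_eq_right (h : L.j a b = b) : L.m a b = a := by
  rw [← h, L.abs1]

theorem m_eq_right_of_j_eq_left (h : L.j a b = a) : L.m a b = b := by
  rw [← h, L.abs4]

theorem nle.m_left (h : L.nle a b) : L.m a b = a := m_eq_left_of_j_eq_right h.1

theorem nle.m_right (h : L.nle a b) : L.m b a = a := m_eq_right_of_j_eq_left h.2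

theorem nle.antisymm (h : L.nle a b) (h' : L.nle b a) : a = b := by
  rw [← h'.2, h.1]

theorem nle.trans (h : L.nle a b) (h' : L.nle b c) : L.nle a c := by
  constructor
  · rw [← h'.1, ← L.j_assoc, h.1]
  · rw [← h'.2, L.j_assoc, h.2]

theorem nle_sandwich (u x : S) : L.nle u (L.j (L.j u x) u) := by
  constructor
  · rw [← L.j_assoc, ← L.j_assoc, L.j_idem]
  · rw [L.j_assoc, L.j_idem]

theorem nle.join (ha : L.nle p a) (hb : L.nle p b) : L.nle p (L.j a b) := by
  constructor
  · rw [← L.j_assoc, ha.1]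
  · rw [L.j_assoc, hb.2]

namespace CoStronglyDistributive

theorem nle_meet (hL : L.CoStronglyDistributive) (ha : L.nle p a) (hb : L.nle p b) :
    L.nle p (L.m a b) := by
  constructor
  · rw [hL.1, ha.1, hb.1]
  · rw [hL.2, ha.2, hb.2]

theorem j_comm_of_nle (hL : L.CoStronglyDistributive) (ha : L.nle p a) (hb : L.nle p b) :
    L.j a b = L.j b a := by
  have h₁ : L.m (L.j a b) a = a := by
    have := hL.1 a b p
    rwa [hb.m_right, ha.2, eq_comm] at this
  have h₂ : L.m a (L.j b a) = a := by
    have := hL.2 p b a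
    rwa [hb.m_left, ha.1, eq_comm] at this
  rw [← j_eq_left_of_m_eq_right h₁, L.j_assoc, j_eq_right_of_m_eq_left h₂]

theorem m_comm_of_nle (hL : L.CoStronglyDistributive) (ha : L.nle p a) (hb : L.nle p b) :
    L.m a b = L.m b a := by
  have hj := hL.j_comm_of_nle ha hb
  calc L.m a b = L.m (L.m (L.j b a) a) (L.m b (L.j b a)) := by rw [L.abs4, L.abs1]
    _ = L.m (L.m (L.j b a) (L.j a a)) (L.m (L.j b b) (L.j a b)) := by
        rw [L.j_idem, L.j_idem, hj]
    _ = L.j (L.m b a) (L.m a b) := by rw [hL.1, hL.2, hL.2]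
    _ = L.m (L.m (L.j b a) (L.j b b)) (L.m (L.j a a) (L.j a b)) := by rw [hL.2, hL.1, hL.1]
    _ = L.m b a := by rw [← hj, L.j_idem, L.j_idem, L.abs4, L.abs1]

end CoStronglyDistributive

/-- The elements above `p` in the natural partial order. -/
@[ext]
structure Upset (L : SkewLattice S) (p : S) where
  val : S
  nle_val : L.nle p val

/-- In a co-strongly distributive skew lattice every upset is a lattice. -/
@[reducible]
def Upset.lattice (hL : L.CoStronglyDistributive) (p : S) : Lattice (L.Upset p) :=
  letI : Max (L.Upset p) := ⟨fun a b => ⟨L.j a.1 b.1, a.2.join b.2⟩⟩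
  letI : Min (L.Upset p) := ⟨fun a b => ⟨L.m a.1 b.1, hL.nle_meet a.2 b.2⟩⟩
  Lattice.mk'
    (fun a b => Upset.ext (hL.j_comm_of_nle a.2 b.2))
    (fun a b c => Upset.ext (L.j_assoc a.1 b.1 c.1))
    (fun a b => Upset.ext (hL.m_comm_of_nle a.2 b.2))
    (fun a b c => Upset.ext (L.m_assoc a.1 b.1 c.1))
    (fun a b => Upset.ext (L.abs2 a.1 b.1))
    (fun a b => Upset.ext (L.abs1 a.1 b.1))

/-- In a co-strongly distributive skew lattice every upset is a distributive lattice. -/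
@[reducible]
def Upset.distribLattice (hL : L.CoStronglyDistributive) (p : S) :
    DistribLattice (L.Upset p) :=
  letI := Upset.lattice hL p
  { Upset.lattice hL p with
    le_sup_inf := fun a b c => (Upset.ext (hL.1 a.1 b.1 c.1).symm :
      (a ⊔ b) ⊓ (a ⊔ c) = a ⊔ b ⊓ c).le }

/-- If `r` is R-related and `l` is L-related to `y`, then `r ∧ l = y`. -/
theorem m_eq_of_rRel_of_lRel {y r l : S} (hr : L.rRel y r) (hl : L.lRel l y) :
    L.m r l = y := by
  obtain ⟨hyr, hry⟩ := hr
  obtain ⟨hly, hyl⟩ := hl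
  have hr' : L.m y (L.m l r) = r := by rw [← L.m_assoc, hyl, hyr]
  have hl' : L.m (L.m l r) y = l := by rw [L.m_assoc, hry, hly]
  calc L.m r l = L.m (L.m y (L.m l r)) (L.m (L.m l r) y) := by rw [hr', hl']
    _ = L.m (L.m y (L.m (L.m l r) (L.m l r))) y := by simp only [L.m_assoc]
    _ = y := by rw [L.m_idem, hr', hry]

end SkewLattice

namespace SkewHeytingAlgebra

variable {S : Type*} (A : SkewHeytingAlgebra S)

theorem nle_himp (x y : S) : A.nle y (A.himp x y) := by
  rw [A.himp_spec.1]
  exact (A.himp_spec.2 _ _ (nle_sandwich y x)).1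

theorem himp_m_sandwich (x y : S) : A.m (A.himp x y) (A.j (A.j y x) y) = y := by
  have h := A.himp_spec.2 _ _ (nle_sandwich (L := A.toSkewLattice) y x)
  rw [← A.himp_spec.1] at h
  exact h.2.1.antisymm (A.costrong.nle_meet h.1 (nle_sandwich y x))

theorem sandwich_m_himp (x y : S) : A.m (A.j (A.j y x) y) (A.himp x y) = y := by
  rw [A.costrong.m_comm_of_nle (nle_sandwich y x) (A.nle_himp x y), himp_m_sandwich]

theorem himp_self (x : S) : A.himp x x = A.one := by
  have hx : A.nle x A.one := A.top x
  have h := A.himp_spec.2 x x ⟨A.j_idem x, A.j_idem x⟩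
  refine nle.antisymm (A.top _) (h.2.2 _ hx ?_)
  rw [hx.m_right]
  exact ⟨A.j_idem x, A.j_idem x⟩

theorem m_himp_m (x y : S) : A.m (A.m x (A.himp x y)) x = A.m (A.m x y) x := by
  have hy := A.nle_himp x y
  have hha := A.himp_m_sandwich x y
  have hah := A.sandwich_m_himp x y
  set h := A.himp x y
  have hr : A.rRel y (A.m (A.j x y) h) := by
    constructor
    · apply m_eq_right_of_j_eq_left
      rw [A.costrong.1, ← A.j_assoc, hy.1, hah]
    · nth_rw 1 [← hy.2]
      rw [← A.costrong.2, A.abs4]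
  have hl : A.lRel (A.m h (A.j y x)) y := by
    constructor
    · apply m_eq_left_of_j_eq_right
      rw [A.costrong.2, hy.2, hha]
    · nth_rw 1 [← hy.1]
      rw [← A.costrong.1, A.abs1]
  have key := m_eq_of_rRel_of_lRel hr hl
  calc A.m (A.m x h) x
      = A.m (A.m (A.m x (A.j x y)) (A.m h h)) (A.m (A.j y x) x) := by
        rw [A.abs1, A.abs4, A.m_idem]
    _ = A.m (A.m x (A.m (A.m (A.j x y) h) (A.m h (A.j y x)))) x := by
        simp only [A.m_assoc]
    _ = A.m (A.m x y) x := by rw [key]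

/-- For `y` above `p`, the element `x → y` is the Heyting implication
`(p ∨ x ∨ p) → y` computed in the upset of `p`. -/
theorem le_himp_iff {p : S} (x : S) (y w : A.Upset p) :
    letI := Upset.distribLattice A.costrong p
    w ≤ (⟨A.himp x y.1, y.2.trans (A.nle_himp x y.1)⟩ : A.Upset p) ↔
      w ⊓ ⟨A.j (A.j p x) p, nle_sandwich p x⟩ ≤ y := by
  let := Upset.distribLattice A.costrong p
  set H : A.Upset p := ⟨A.himp x y.1, y.2.trans (A.nle_himp x y.1)⟩
  set X : A.Upset p := ⟨A.j (A.j p x) p, nle_sandwich p x⟩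
  have hXy : A.j (A.j y.1 x) y.1 = (y ⊔ X ⊔ y).1 := by
    change _ = A.j (A.j y.1 (A.j (A.j p x) p)) y.1
    rw [← A.j_assoc y.1, ← A.j_assoc y.1, y.2.2, A.j_assoc _ p, y.2.1]
  have hHX : H ⊓ (y ⊔ X ⊔ y) = y := by
    apply Upset.ext
    change A.m (A.himp x y.1) (y ⊔ X ⊔ y).1 = _
    rw [← hXy, himp_m_sandwich]
  constructor
  · intro hw
    calc w ⊓ X ≤ H ⊓ (y ⊔ X ⊔ y) := inf_le_inf hw (le_sup_right.trans le_sup_left)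
      _ = y := hHX
  · intro hw
    have hwX : (w ⊔ y) ⊓ (y ⊔ X ⊔ y) = y := by
      rw [sup_right_comm, sup_idem, sup_comm y X, ← sup_inf_right]
      exact sup_eq_right.2 hw
    have hle := (A.himp_spec.2 _ _ (nle_sandwich (L := A.toSkewLattice) y.1 x)).2.2 (w ⊔ y).1
      ⟨congrArg Upset.val (sup_eq_right.2 (le_sup_right : y ≤ w ⊔ y)),
        congrArg Upset.val (sup_eq_left.2 (le_sup_right : y ≤ w ⊔ y))⟩
      (by
        rw [hXy]
        change A.nle ((w ⊔ y) ⊓ (y ⊔ X ⊔ y)).1 y.1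
        rw [hwX]
        exact ⟨A.j_idem _, A.j_idem _⟩)
    rw [← A.himp_spec.1] at hle
    exact le_sup_left.trans (sup_eq_right.1 (Upset.ext hle.1) : w ⊔ y ≤ H)

theorem himp_meet {p y z : S} (x : S) (hy : A.nle p y) (hz : A.nle p z) :
    A.himp x (A.m y z) = A.m (A.himp x y) (A.himp x z) := by
  let := Upset.distribLattice A.costrong p
  let y' : A.Upset p := ⟨y, hy⟩
  let z' : A.Upset p := ⟨z, hz⟩
  refine congrArg Upset.val (eq_of_forall_le_iff fun w => ?_ :
    (⟨A.himp x (y' ⊓ z').1, (y' ⊓ z').2.trans (A.nle_himp x _)⟩ : A.Upset p) =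
      ⟨A.himp x y, hy.trans (A.nle_himp x y)⟩ ⊓ ⟨A.himp x z, hz.trans (A.nle_himp x z)⟩)
  rw [le_inf_iff, A.le_himp_iff x (y' ⊓ z') w, le_inf_iff]
  exact and_congr (A.le_himp_iff x y' w).symm (A.le_himp_iff x z' w).symm

end SkewHeytingAlgebra

/-- every skew Heyting algebra satisfies (SH1)-(SH4). -/
theorem stmt_6 {S : Type*} (A : SkewHeytingAlgebra S) (x y z u : S) :
    A.himp x x = A.one ∧
    A.m (A.m x (A.himp x y)) x = A.m (A.m x y) x ∧
    (A.m y (A.himp x y) = y ∧ A.m (A.himp x y) y = y) ∧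
    A.himp x (A.j (A.j u (A.m y z)) u) =
      A.m (A.himp x (A.j (A.j u y) u)) (A.himp x (A.j (A.j u z) u)) := by
  refine ⟨A.himp_self x, A.m_himp_m x y,
    ⟨(A.nle_himp x y).m_left, (A.nle_himp x y).m_right⟩, ?_⟩
  rw [A.costrong.1, A.costrong.2]
  exact A.himp_meet x (nle_sandwich u y) (nle_sandwich u z)
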